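/- arXiv:1708.07367 — 2 statements merged into one kernel-verified Lean document; each statement's English description precedes it below -/
import Mathlib

section
/- Fix δ ∈ (0,1), a constant c > 1, and a smoothing parameter α > 0. Let t̂ = inf{ t ≥ 0 : 2d²·(1 + ⌈log_c(2n/t)⌉₊)·e^{−t} ≤ δ }. Then with probability at least 1 − δ, for all (i,j) ∈ [d]²: |P̂_{i,j} − P_{i,j}| ≤ sqrt( (N_i/(N_i + dα)) · 2c P_{i,j}(1 − P_{i,j}) t̂ / (N_i + dα) ) + (4/3) t̂ / (N_i + dα) + |α − dα P_{i,j}| / (N_i + dα). -/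
open Finset Matrix Real MeasureTheory
open scoped Classical BigOperators

namespace MCEst

/-- A row-stochastic matrix. -/
def IsStochastic {d : ℕ} (P : Matrix (Fin d) (Fin d) ℝ) : Prop :=
  (∀ i j, 0 ≤ P i j) ∧ ∀ i, ∑ j, P i j = 1

/-- A probability vector. -/
def IsProbVec {d : ℕ} (q : Fin d → ℝ) : Prop :=
  (∀ i, 0 ≤ q i) ∧ ∑ i, q i = 1

/-- Ergodicity (irreducibility + aperiodicity) of a finite stochastic matrix,
expressed as primitivity. -/
def IsErgodic {d : ℕ} (P : Matrix (Fin d) (Fin d) ℝ) : Prop :=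
  ∃ k : ℕ, ∀ i j, 0 < (P ^ k) i j

/-- `π` is a stationary distribution of `P`. -/
def IsStationary {d : ℕ} (P : Matrix (Fin d) (Fin d) ℝ) (w : Fin d → ℝ) : Prop :=
  IsProbVec w ∧ ∀ j, ∑ i, w i * P i j = w j

/-- Reversibility (detailed balance) of `P` w.r.t. `π`. -/
def IsReversible {d : ℕ} (P : Matrix (Fin d) (Fin d) ℝ) (w : Fin d → ℝ) : Prop :=
  ∀ i j, w i * P i j = w j * P j i

/-- The absolute spectral gap: one minus the largest absolute value of an
eigenvalue (root of the characteristic polynomial) different from 1. -/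
noncomputable def absSpectralGap {d : ℕ} (P : Matrix (Fin d) (Fin d) ℝ) : ℝ :=
  1 - sSup {x : ℝ | ∃ μ : ℝ, μ ≠ 1 ∧ P.charpoly.IsRoot μ ∧ x = |μ|}

/-- Minimum entry of a vector. -/
noncomputable def minEntry {d : ℕ} (v : Fin d → ℝ) : ℝ := ⨅ i, v i

/-- Probability of observing the sample path `x` (0-indexed, i.e. `x 0 = X_1`)
when the chain has initial distribution `q` and transition matrix `P`. -/
noncomputable def pathProb {d n : ℕ} (q : Fin d → ℝ) (P : Matrix (Fin d) (Fin d) ℝ)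
    (x : Fin n → Fin d) : ℝ :=
  ∏ t : Fin n,
    if (t : ℕ) = 0 then q (x t)
    else P (x ⟨(t : ℕ) - 1, by have := t.isLt; omega⟩) (x t)

/-- Probability of an event for the length-`n` sample path of the chain. -/
noncomputable def prob {d n : ℕ} (q : Fin d → ℝ) (P : Matrix (Fin d) (Fin d) ℝ)
    (E : Set (Fin n → Fin d)) : ℝ :=
  ∑ x : Fin n → Fin d, if x ∈ E then pathProb q P x else 0

/-- The successor of an index within `Fin n` (cyclically). -/
def succAt {n : ℕ} (t : Fin n) : Fin n :=
  ⟨((t : ℕ) + 1) % n, Nat.mod_lt _ (by have := t.isLt; omega)⟩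

/-- Empirical state frequencies. -/
noncomputable def pihat {d n : ℕ} (x : Fin n → Fin d) (i : Fin d) : ℝ :=
  ((univ.filter fun t => x t = i).card : ℝ) / n

/-- Empirical doublet frequencies. -/
noncomputable def Mhat {d n : ℕ} (x : Fin n → Fin d) : Matrix (Fin d) (Fin d) ℝ :=
  Matrix.of fun i j =>
    ((univ.filter fun t : Fin n => (t : ℕ) + 1 < n ∧ x t = i ∧ x (succAt t) = j).card : ℝ)
      / ((n : ℝ) - 1)

/-- Number of visits to `i` among the first `n-1` states. -/
def Ncount {d n : ℕ} (x : Fin n → Fin d) (i : Fin d) : ℕ :=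
  (univ.filter fun t : Fin n => (t : ℕ) + 1 < n ∧ x t = i).card

/-- Number of observed transitions from `i` to `j`. -/
def Npair {d n : ℕ} (x : Fin n → Fin d) (i j : Fin d) : ℕ :=
  (univ.filter fun t : Fin n => (t : ℕ) + 1 < n ∧ x t = i ∧ x (succAt t) = j).card

/-- Plug-in estimate of the matrix L. -/
noncomputable def Lhat {d n : ℕ} (x : Fin n → Fin d) : Matrix (Fin d) (Fin d) ℝ :=
  Matrix.of fun i j => Mhat x i j / (Real.sqrt (pihat x i) * Real.sqrt (pihat x j))

/-- Symmetrization of a square matrix. -/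
noncomputable def symPart {d : ℕ} (A : Matrix (Fin d) (Fin d) ℝ) : Matrix (Fin d) (Fin d) ℝ :=
  (1 / 2 : ℝ) • (A + Aᵀ)

lemma symPart_isHermitian {d : ℕ} (A : Matrix (Fin d) (Fin d) ℝ) :
    (symPart A).IsHermitian := by
  unfold symPart Matrix.IsHermitian
  ext i j
  simp [Matrix.conjTranspose_apply, Matrix.transpose_apply, Matrix.add_apply,
    Matrix.smul_apply]
  ring

/-- Eigenvalues of a hermitian matrix sorted in ascending order. -/
noncomputable def lamAsc {d : ℕ} {A : Matrix (Fin d) (Fin d) ℝ} (hA : A.IsHermitian) :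
    Fin d → ℝ :=
  hA.eigenvalues ∘ Tuple.sort hA.eigenvalues

/-- The plug-in spectral gap estimator γ̂⋆ = 1 - min{1, max{λ̂₂, |λ̂_d|}}
(equal to 0 when some empirical frequency vanishes). -/
noncomputable def gapEstimator {d n : ℕ} (x : Fin n → Fin d) : ℝ :=
  if h : 1 < d ∧ ∀ i, 0 < pihat x i then
    1 - min 1 (max (lamAsc (symPart_isHermitian (Lhat x)) ⟨d - 2, by have := h.1; omega⟩)
        |lamAsc (symPart_isHermitian (Lhat x)) ⟨0, by have := h.1; omega⟩|)
  else 0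

/-- Spectral norm (ℓ²-operator norm) of a real square matrix. -/
noncomputable def specNorm {d : ℕ} (A : Matrix (Fin d) (Fin d) ℝ) : ℝ :=
  ‖Matrix.toEuclideanCLM (𝕜 := ℝ) A‖

/-- The matrix L = Diag(π)^{1/2} P Diag(π)^{-1/2}. -/
noncomputable def Lgen {d : ℕ} (w : Fin d → ℝ) (P : Matrix (Fin d) (Fin d) ℝ) :
    Matrix (Fin d) (Fin d) ℝ :=
  Matrix.of fun i j => Real.sqrt (w i) * P i j / Real.sqrt (w j)

/-- Laplace-smoothed transition probability estimates. -/
noncomputable def Phat {d n : ℕ} (α : ℝ) (x : Fin n → Fin d) : Matrix (Fin d) (Fin d) ℝ :=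
  Matrix.of fun i j => ((Npair x i j : ℝ) + α) / ((Ncount x i : ℝ) + d * α)

/-- The threshold t̂ from the algorithm. -/
noncomputable def that (d n : ℕ) (c δ : ℝ) : ℝ :=
  sInf {t : ℝ | 0 ≤ t ∧
    2 * (d : ℝ) ^ 2 * (1 + (⌈Real.logb c (2 * n / t)⌉₊ : ℝ)) * Real.exp (-t) ≤ δ}

/-- The empirical bound B̂_{i,j}. -/
noncomputable def Bhat {d n : ℕ} (α c δ : ℝ) (x : Fin n → Fin d) (i j : Fin d) : ℝ :=
  (Real.sqrt (c * that d n c δ / (2 * (Ncount x i : ℝ))) +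
    Real.sqrt (c * that d n c δ / (2 * (Ncount x i : ℝ)) +
      Real.sqrt (2 * c * Phat α x i j * (1 - Phat α x i j) * that d n c δ / (Ncount x i : ℝ)) +
      ((4 / 3) * that d n c δ + |α - d * α * Phat α x i j|) / (Ncount x i : ℝ))) ^ 2

/-- Group inverse of a square matrix (when it exists). -/
noncomputable def groupInv {d : ℕ} (A : Matrix (Fin d) (Fin d) ℝ) :
    Matrix (Fin d) (Fin d) ℝ :=
  if h : ∃ G, A * G * A = A ∧ G * A * G = G ∧ A * G = G * A then h.choose else 0

/-- The (unique) stationary distribution of `P` (when it exists). -/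
noncomputable def statDist {d : ℕ} (P : Matrix (Fin d) (Fin d) ℝ) : Fin d → ℝ :=
  if h : ∃ w, IsStationary P w then h.choose else 0

/-- The a-skipped sample path (X_a, X_{2a}, ..., X_{(n/a)·a}). -/
def skipPath {d n : ℕ} (a : ℕ) (x : Fin n → Fin d) : Fin (n / a) → Fin d :=
  fun s => x ⟨a * s.1 + (a - 1), by
    have hs := s.isLt
    rcases Nat.eq_zero_or_pos a with h | h
    · subst h; simp [Nat.div_zero] at hs
    · have h2 : a * (s.1 + 1) ≤ a * (n / a) := Nat.mul_le_mul_left a hs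
      have h3 : a * (n / a) ≤ n := Nat.mul_div_le n a
      have h4 : a * (s.1 + 1) = a * s.1 + a := Nat.mul_succ a s.1
      omega⟩

/-- The skip amount A = 2^k chosen by the doubling procedure. -/
noncomputable def Askip {d n : ℕ} (x : Fin n → Fin d) : ℕ :=
  if h : ∃ k : ℕ, 0.31 < gapEstimator (skipPath (2 ^ k) x) ∨ 2 ^ k = n then
    2 ^ Nat.find h
  else n

/-- The doubling-skip estimator γ̃⋆ = 1 - (1 - γ̂⋆(A))^{1/A}. -/
noncomputable def tildeGap {d n : ℕ} (x : Fin n → Fin d) : ℝ :=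
  1 - (1 - gapEstimator (skipPath (Askip x) x)) ^ ((Askip x : ℝ)⁻¹)

/-- Transition matrix with moves into `j` suppressed. -/
noncomputable def avoid {d : ℕ} (P : Matrix (Fin d) (Fin d) ℝ) (j : Fin d) :
    Matrix (Fin d) (Fin d) ℝ :=
  Matrix.of fun k l => if l = j then 0 else P k l

/-- Expected first positive hitting time of `j` starting from `i`:
`E_i[τ_j] = ∑_{t ≥ 0} Pr_i(τ_j > t)`. -/
noncomputable def expHit {d : ℕ} (P : Matrix (Fin d) (Fin d) ℝ) (i j : Fin d) : ℝ :=
  ∑' t : ℕ, ∑ l, ((avoid P j) ^ t) i l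

/-- The mixing time of the chain. -/
noncomputable def mixingTime {d : ℕ} (P : Matrix (Fin d) (Fin d) ℝ) (w : Fin d → ℝ) : ℕ :=
  sInf {t : ℕ | ∀ q : Fin d → ℝ, IsProbVec q →
    ∀ A : Finset (Fin d), |∑ i ∈ A, ((q ᵥ* (P ^ t)) i - w i)| ≤ 1 / 4}

/-- Algorithm 1: smoothed transition probability estimates (α = 1/d). -/
noncomputable def algPhat {d n : ℕ} (x : Fin n → Fin d) : Matrix (Fin d) (Fin d) ℝ :=
  Phat (1 / (d : ℝ)) x

/-- Algorithm 1: stationary distribution of the smoothed estimate. -/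
noncomputable def algPi {d n : ℕ} (x : Fin n → Fin d) : Fin d → ℝ :=
  statDist (algPhat x)

/-- Algorithm 1: spectral gap estimate. -/
noncomputable def algGap {d n : ℕ} (x : Fin n → Fin d) : ℝ :=
  if h : 1 < d then
    1 - max (lamAsc (symPart_isHermitian (Lgen (algPi x) (algPhat x))) ⟨d - 2, by omega⟩)
        |lamAsc (symPart_isHermitian (Lgen (algPi x) (algPhat x))) ⟨0, by omega⟩|
  else 0

/-- Algorithm 1: relative sensitivity κ̂ computed from the group inverse. -/
noncomputable def algKappa {d n : ℕ} (x : Fin n → Fin d) : ℝ :=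
  (1 / 2) * ⨆ j, (groupInv (1 - algPhat x) j j - ⨅ i, groupInv (1 - algPhat x) i j)

/-- Algorithm 1: bound b̂ on the stationary distribution error. -/
noncomputable def algb {d n : ℕ} (δ : ℝ) (x : Fin n → Fin d) : ℝ :=
  algKappa x * ⨆ i, ⨆ j, Bhat (1 / (d : ℝ)) 1.1 δ x i j

/-- Algorithm 1: the quantity ρ̂. -/
noncomputable def algRho {d n : ℕ} (δ : ℝ) (x : Fin n → Fin d) : ℝ :=
  (1 / 2) * ⨆ i, max (algb δ x / algPi x i) (algb δ x / max 0 (algPi x i - algb δ x))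

/-- Algorithm 1: bound ŵ on the spectral gap error. -/
noncomputable def algw {d n : ℕ} (δ : ℝ) (x : Fin n → Fin d) : ℝ :=
  2 * algRho δ x + algRho δ x ^ 2 +
    (1 + 2 * algRho δ x + algRho δ x ^ 2) *
      Real.sqrt (∑ i, ∑ j, (algPi x i / algPi x j) * Bhat (1 / (d : ℝ)) 1.1 δ x i j ^ 2)

/-- Observable lower bound on the minimum stationary probability from Algorithm 1. -/
noncomputable def algPiLB {d n : ℕ} (δ : ℝ) (x : Fin n → Fin d) : ℝ :=
  ⨅ i, max 0 (algPi x i - algb δ x)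

/-- Observable lower bound on the spectral gap from Algorithm 1. -/
noncomputable def algGapLB {d n : ℕ} (δ : ℝ) (x : Fin n → Fin d) : ℝ :=
  max 0 (algGap x - algw δ x)

/-- A Padé-type upper bound on the exponential. -/
lemma exp_le_of_le_of_lt_three {y l : ℝ} (hyl : y ≤ l) (hl0 : 0 ≤ l) (hl : l < 3) :
    Real.exp y ≤ 1 + y + y ^ 2 * (1 / (2 * (1 - l / 3))) := by
  rcases le_total y 0 with hy | hy
  · have h1 := Real.quadratic_le_exp_of_nonneg (x := -y) (by linarith)
    have h2 : Real.exp y * Real.exp (-y) = 1 := by rw [← Real.exp_add]; simp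
    have h3 : Real.exp y ≤ 1 + y + y ^ 2 / 2 := by
      have h4 : 0 < Real.exp (-y) := Real.exp_pos _
      have h5 : 0 ≤ 1 + y + y ^ 2 / 2 := by nlinarith [sq_nonneg (1 + y)]
      refine le_of_mul_le_mul_right ?_ h4
      rw [h2]
      nlinarith [mul_le_mul_of_nonneg_left h1 h5, sq_nonneg (y ^ 2)]
    have h6 : 1 / 2 ≤ 1 / (2 * (1 - l / 3)) :=
      one_div_le_one_div_of_le (by linarith) (by linarith)
    nlinarith [mul_le_mul_of_nonneg_left h6 (sq_nonneg y)]
  · have hmono : MonotoneOn (fun z : ℝ => (6 + 4 * z + z ^ 2) * Real.exp (-z) - (6 - 2 * z))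
        (Set.Ici 0) := by
      have hder : ∀ z : ℝ, HasDerivAt
          (fun z : ℝ => (6 + 4 * z + z ^ 2) * Real.exp (-z) - (6 - 2 * z))
          (2 - (2 + 2 * z + z ^ 2) * Real.exp (-z)) z := by
        intro z
        have h1 : HasDerivAt (fun z : ℝ => 6 + 4 * z + z ^ 2) (4 + 2 * z) z := by
          exact ((((hasDerivAt_id' z).const_mul 4).const_add 6).fun_add (hasDerivAt_pow 2 z)).congr_deriv
            (by norm_num)
        have h2 : HasDerivAt (fun z : ℝ => Real.exp (-z)) (-Real.exp (-z)) z := by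
          simpa using (hasDerivAt_neg z).exp
        have h3 : HasDerivAt (fun z : ℝ => 6 - 2 * z) (-2) z := by
          simpa using ((hasDerivAt_id z).const_mul 2).const_sub 6
        exact ((h1.mul h2).sub h3).congr_deriv (by ring)
      refine monotoneOn_of_deriv_nonneg (convex_Ici 0)
        (fun z _ => (hder z).continuousAt.continuousWithinAt)
        (fun z _ => (hder z).differentiableAt.differentiableWithinAt) fun z hz => ?_
      rw [interior_Ici] at hz
      rw [(hder z).deriv]
      have h1 := Real.quadratic_le_exp_of_nonneg (le_of_lt hz)
      have h2 : Real.exp z * Real.exp (-z) = 1 := by rw [← Real.exp_add]; simp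
      nlinarith [mul_le_mul_of_nonneg_right h1 (Real.exp_pos (-z)).le]
    have h0 := hmono (Set.mem_Ici.2 le_rfl) (Set.mem_Ici.2 hy) hy
    simp only [mul_zero, add_zero, neg_zero, Real.exp_zero] at h0
    have h2 : Real.exp y * Real.exp (-y) = 1 := by rw [← Real.exp_add]; simp
    have h4 : Real.exp y * (6 - 2 * y) ≤ 6 + 4 * y + y ^ 2 := by
      have h5 : 6 - 2 * y ≤ (6 + 4 * y + y ^ 2) * Real.exp (-y) := by linarith
      have h6 := mul_le_mul_of_nonneg_left h5 (Real.exp_pos y).le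
      linear_combination h6 + (6 + 4 * y + y ^ 2) * h2
    have h7 : Real.exp y ≤ 1 + y + y ^ 2 * (1 / (2 * (1 - y / 3))) := by
      have h8 : (0 : ℝ) < 6 - 2 * y := by linarith
      have h9 : 1 + y + y ^ 2 * (1 / (2 * (1 - y / 3))) = (6 + 4 * y + y ^ 2) / (6 - 2 * y) := by
        have h10 : 2 * (1 - y / 3) = (6 - 2 * y) / 3 := by ring
        rw [h10, one_div_div, eq_div_iff h8.ne', add_mul, mul_assoc, div_mul_cancel₀ _ h8.ne']
        ring
      rw [h9, le_div_iff₀ h8]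
      exact h4
    have h11 : 1 / (2 * (1 - y / 3)) ≤ 1 / (2 * (1 - l / 3)) :=
      one_div_le_one_div_of_le (by linarith) (by linarith)
    nlinarith [mul_le_mul_of_nonneg_left h11 (sq_nonneg y)]

/-- Bernstein bound on the moment generating function of a signed centered indicator. -/
lemma sum_mul_exp_indicator_le {ι : Type*} [Fintype ι] [DecidableEq ι] {r : ι → ℝ} (hr0 : ∀ b, 0 ≤ r b)
    (hr1 : ∑ b, r b = 1) (j : ι) {s l : ℝ} (hs : |s| = 1) (hl0 : 0 ≤ l) (hl : l < 3) :
    ∑ b, r b * Real.exp (l * (s * ((if b = j then 1 else 0) - r j)) -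
      l ^ 2 / (2 * (1 - l / 3)) * (r j * (1 - r j))) ≤ 1 := by
  have hp1 : r j ≤ 1 := hr1 ▸ Finset.single_le_sum (fun b _ => hr0 b) (Finset.mem_univ j)
  have hp0 := hr0 j
  have hs2 : s ^ 2 = 1 := by rw [← sq_abs, hs, one_pow]
  set p := r j with hp
  set v := l ^ 2 / (2 * (1 - l / 3)) with hv
  have hb : ∀ b, r b * Real.exp (l * (s * ((if b = j then 1 else 0) - p))) ≤
      r b * (1 + l * (s * ((if b = j then 1 else 0) - p)) +
        v * ((if b = j then 1 else 0) - p) ^ 2) := by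
    intro b
    refine mul_le_mul_of_nonneg_left ?_ (hr0 b)
    have habs : s * ((if b = j then 1 else 0) - p) ≤ 1 := by
      refine (le_abs_self _).trans ?_
      rw [abs_mul, hs, one_mul, abs_le]
      split_ifs <;> constructor <;> linarith
    refine (exp_le_of_le_of_lt_three (mul_le_of_le_one_right hl0 habs) hl0 hl).trans
      (le_of_eq ?_)
    rw [hv, mul_pow, mul_pow, hs2]
    ring
  have hsum : ∑ b, r b * (1 + l * (s * ((if b = j then 1 else 0) - p)) +
      v * ((if b = j then 1 else 0) - p) ^ 2) = 1 + v * (p * (1 - p)) := by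
    have : ∀ b, r b * (1 + l * (s * ((if b = j then 1 else 0) - p)) +
        v * ((if b = j then 1 else 0) - p) ^ 2) =
        (1 - l * s * p + v * p ^ 2) * r b +
          (l * s + v - 2 * v * p) * (if b = j then r b else 0) := by
      intro b
      split_ifs <;> ring
    simp only [this]
    rw [Finset.sum_add_distrib, ← Finset.mul_sum, ← Finset.mul_sum, hr1,
      Finset.sum_ite_eq' Finset.univ j r, if_pos (Finset.mem_univ j), ← hp]
    ring
  have hexp : ∑ b, r b * Real.exp (l * (s * ((if b = j then 1 else 0) - p))) ≤
      Real.exp (v * (p * (1 - p))) :=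
    (Finset.sum_le_sum fun b _ => hb b).trans
      (by rw [hsum, add_comm]; exact Real.add_one_le_exp _)
  simp only [Real.exp_sub, ← mul_div_assoc]
  rw [← Finset.sum_div]
  exact (div_le_one (Real.exp_pos _)).2 hexp

lemma sum_path_succ {d : ℕ} (q : Fin d → ℝ) (K : Fin d → Fin d → ℝ) (m : ℕ) :
    ∑ x : Fin (m + 2) → Fin d, q (x 0) * ∏ t : Fin (m + 1), K (x t.castSucc) (x t.succ) =
    ∑ x : Fin (m + 1) → Fin d,
      (∑ a, q a * K a (x 0)) * ∏ t : Fin m, K (x t.castSucc) (x t.succ) := by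
  rw [← (Fin.consEquiv fun _ : Fin (m + 2) => Fin d).sum_comp, Fintype.sum_prod_type,
    Finset.sum_comm]
  refine Finset.sum_congr rfl fun x _ => ?_
  rw [Finset.sum_mul]
  refine Finset.sum_congr rfl fun a _ => ?_
  rw [Fin.prod_univ_succ]
  simp [Fin.consEquiv, mul_assoc]

lemma sum_path_le {d : ℕ} {K : Fin d → Fin d → ℝ} (hK0 : ∀ a b, 0 ≤ K a b)
    (hK1 : ∀ a, ∑ b, K a b ≤ 1) (m : ℕ) : ∀ q : Fin d → ℝ, (∀ a, 0 ≤ q a) →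
    ∑ x : Fin (m + 1) → Fin d, q (x 0) * ∏ t : Fin m, K (x t.castSucc) (x t.succ) ≤
      ∑ a, q a := by
  induction m with
  | zero =>
    intro q _
    rw [← (Equiv.funUnique (Fin 1) (Fin d)).symm.sum_comp]
    simp
  | succ m ih =>
    intro q hq
    rw [sum_path_succ]
    refine (ih (fun b => ∑ a, q a * K a b)
      fun b => Finset.sum_nonneg fun a _ => mul_nonneg (hq a) (hK0 a b)).trans ?_
    rw [Finset.sum_comm]
    refine Finset.sum_le_sum fun a _ => ?_
    rw [← Finset.mul_sum]
    exact mul_le_of_le_one_right (hq a) (hK1 a)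

lemma sum_path_eq {d : ℕ} {K : Fin d → Fin d → ℝ} (hK1 : ∀ a, ∑ b, K a b = 1) (m : ℕ) :
    ∀ q : Fin d → ℝ,
    ∑ x : Fin (m + 1) → Fin d, q (x 0) * ∏ t : Fin m, K (x t.castSucc) (x t.succ) =
      ∑ a, q a := by
  induction m with
  | zero =>
    intro q
    rw [← (Equiv.funUnique (Fin 1) (Fin d)).symm.sum_comp]
    simp
  | succ m ih =>
    intro q
    rw [sum_path_succ, ih fun b => ∑ a, q a * K a b, Finset.sum_comm]
    refine Finset.sum_congr rfl fun a _ => ?_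
    rw [← Finset.mul_sum, hK1, mul_one]

lemma pathProb_succ {d m : ℕ} (q : Fin d → ℝ) (P : Matrix (Fin d) (Fin d) ℝ)
    (x : Fin (m + 1) → Fin d) :
    pathProb q P x = q (x 0) * ∏ t : Fin m, P (x t.castSucc) (x t.succ) := by
  rw [pathProb, Fin.prod_univ_succ]
  congr 1

lemma pathProb_nonneg {d n : ℕ} {q : Fin d → ℝ} {P : Matrix (Fin d) (Fin d) ℝ}
    (hP0 : ∀ i j, 0 ≤ P i j) (hq0 : ∀ i, 0 ≤ q i) (x : Fin n → Fin d) :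
    0 ≤ pathProb q P x := by
  refine Finset.prod_nonneg fun t _ => ?_
  split_ifs
  · exact hq0 _
  · exact hP0 _ _

lemma succAt_castSucc {m : ℕ} (t : Fin m) : succAt t.castSucc = t.succ := by
  ext
  simp [succAt, Nat.mod_eq_of_lt]

lemma Ncount_succ {d m : ℕ} (x : Fin (m + 1) → Fin d) (i : Fin d) :
    (Ncount x i : ℝ) = ∑ t : Fin m, if x t.castSucc = i then 1 else 0 := by
  rw [Ncount, Finset.card_filter, Fin.sum_univ_castSucc]
  simp

lemma Npair_succ {d m : ℕ} (x : Fin (m + 1) → Fin d) (i j : Fin d) :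
    (Npair x i j : ℝ) =
      ∑ t : Fin m, if x t.castSucc = i ∧ x t.succ = j then 1 else 0 := by
  rw [Npair, Finset.card_filter, Fin.sum_univ_castSucc]
  simp [succAt_castSucc]

lemma prob_univ {d m : ℕ} {q : Fin d → ℝ} {P : Matrix (Fin d) (Fin d) ℝ}
    (hP1 : ∀ i, ∑ j, P i j = 1) (hq : IsProbVec q) :
    prob q P (Set.univ : Set (Fin (m + 1) → Fin d)) = 1 := by
  simp only [prob, Set.mem_univ, if_true, pathProb_succ]
  rw [sum_path_eq hP1, hq.2]

lemma prob_add_prob_compl {d n : ℕ} {q : Fin d → ℝ} {P : Matrix (Fin d) (Fin d) ℝ}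
    (E : Set (Fin n → Fin d)) : prob q P E + prob q P Eᶜ = prob q P (Set.univ : Set (Fin n → Fin d)) := by
  simp only [prob]
  rw [← Finset.sum_add_distrib]
  refine Finset.sum_congr rfl fun x _ => ?_
  by_cases h : x ∈ E <;> simp [h]

lemma prob_le_sum {d n : ℕ} {q : Fin d → ℝ} {P : Matrix (Fin d) (Fin d) ℝ}
    (hP0 : ∀ i j, 0 ≤ P i j) (hq0 : ∀ i, 0 ≤ q i) {ι : Type*} (F : Finset ι)
    (A : ι → Set (Fin n → Fin d)) (B : Set (Fin n → Fin d))
    (hB : ∀ x, x ∈ B → ∃ s ∈ F, x ∈ A s) : prob q P B ≤ ∑ s ∈ F, prob q P (A s) := by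
  simp only [prob]
  rw [Finset.sum_comm]
  refine Finset.sum_le_sum fun x _ => ?_
  have h0 : ∀ s ∈ F, 0 ≤ if x ∈ A s then pathProb q P x else 0 := fun s _ => by
    split_ifs
    · exact pathProb_nonneg hP0 hq0 x
    · exact le_rfl
  by_cases hx : x ∈ B
  · obtain ⟨s, hs, hxs⟩ := hB x hx
    rw [if_pos hx]
    calc pathProb q P x = if x ∈ A s then pathProb q P x else 0 := (if_pos hxs).symm
      _ ≤ _ := Finset.single_le_sum h0 hs
  · rw [if_neg hx]
    exact Finset.sum_nonneg h0

/-- The exponential supermartingale of the transition counts has expectation at most one. -/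
lemma sum_pathProb_mul_exp_le {d m : ℕ} {q : Fin d → ℝ} {P : Matrix (Fin d) (Fin d) ℝ}
    (hP0 : ∀ i j, 0 ≤ P i j) (hP1 : ∀ i, ∑ j, P i j = 1) (hq : IsProbVec q) (i j : Fin d)
    {s l : ℝ} (hs : |s| = 1) (hl0 : 0 ≤ l) (hl : l < 3) :
    ∑ x : Fin (m + 1) → Fin d, pathProb q P x *
      Real.exp (l * (s * (Npair x i j - Ncount x i * P i j)) -
        l ^ 2 / (2 * (1 - l / 3)) * (Ncount x i * (P i j * (1 - P i j)))) ≤ 1 := by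
  set v := l ^ 2 / (2 * (1 - l / 3)) with hv
  let g : Fin d → Fin d → ℝ := fun a b => if a = i then
    l * (s * ((if b = j then 1 else 0) - P i j)) - v * (P i j * (1 - P i j)) else 0
  have hexp : ∀ x : Fin (m + 1) → Fin d,
      l * (s * (Npair x i j - Ncount x i * P i j)) -
        v * (Ncount x i * (P i j * (1 - P i j))) =
      ∑ t : Fin m, g (x t.castSucc) (x t.succ) := by
    intro x
    rw [Ncount_succ, Npair_succ, Finset.sum_mul, Finset.sum_mul, ← Finset.sum_sub_distrib,
      Finset.mul_sum, Finset.mul_sum, Finset.mul_sum, ← Finset.sum_sub_distrib]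
    refine Finset.sum_congr rfl fun t _ => ?_
    by_cases h : x t.castSucc = i <;> simp [g, h]
  have hterm : ∀ x : Fin (m + 1) → Fin d, pathProb q P x *
      Real.exp (l * (s * (Npair x i j - Ncount x i * P i j)) -
        v * (Ncount x i * (P i j * (1 - P i j)))) =
      q (x 0) * ∏ t : Fin m, (fun a b => P a b * Real.exp (g a b)) (x t.castSucc) (x t.succ) := by
    intro x
    rw [hexp, Real.exp_sum, pathProb_succ, mul_assoc, ← Finset.prod_mul_distrib]
  simp only [hterm]
  refine (sum_path_le (K := fun a b => P a b * Real.exp (g a b))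
    (fun a b => mul_nonneg (hP0 a b) (Real.exp_pos _).le) (fun a => ?_) m q hq.1).trans hq.2.le
  by_cases h : a = i
  · subst h
    simpa [g] using sum_mul_exp_indicator_le (hP0 a) (hP1 a) j hs hl0 hl
  · simp [g, h, hP1]

/-- The signed transition count deviates from its compensator by the Bernstein threshold,
while its predictable variance is at most `v`. -/
def deviationEvent {d n : ℕ} (P : Matrix (Fin d) (Fin d) ℝ) (i j : Fin d) (s T v : ℝ) :
    Set (Fin n → Fin d) :=
  {x | Real.sqrt (2 * v * T) + T / 3 ≤ s * (Npair x i j - Ncount x i * P i j) ∧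
    Ncount x i * (P i j * (1 - P i j)) ≤ v}

lemma prob_deviationEvent_le {d m : ℕ} {q : Fin d → ℝ} {P : Matrix (Fin d) (Fin d) ℝ}
    (hP0 : ∀ i j, 0 ≤ P i j) (hP1 : ∀ i, ∑ j, P i j = 1) (hq : IsProbVec q) (i j : Fin d)
    {s T v : ℝ} (hs : |s| = 1) (hT : 0 < T) (hv : 0 < v) :
    prob q P (deviationEvent (n := m + 1) P i j s T v) ≤ Real.exp (-T) := by
  set r := Real.sqrt (2 * T / v) with hr
  have hr0 : 0 < r := Real.sqrt_pos.2 (by positivity)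
  have hr2 : v * r ^ 2 = 2 * T := by
    rw [hr, Real.sq_sqrt (by positivity)]
    field_simp
  have hrv : Real.sqrt (2 * v * T) = v * r := by
    rw [Real.sqrt_eq_iff_mul_self_eq (by positivity) (by positivity)]
    linear_combination -v * hr2
  set l := r / (1 + r / 3) with hl
  have hl0 : 0 < l := by positivity
  have hl3 : l < 3 := by
    rw [hl, div_lt_iff₀ (by positivity)]
    linarith
  set w := l ^ 2 / (2 * (1 - l / 3)) with hw
  have hw0 : 0 ≤ w := div_nonneg (sq_nonneg _) (by linarith)
  have hopt : l * (v * r + T / 3) - w * v = T := by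
    have h1 : 1 - l / 3 = 1 / (1 + r / 3) := by
      rw [hl]
      field_simp
      ring
    have h2 : w = r ^ 2 / (2 * (1 + r / 3)) := by
      rw [hw, h1, hl]
      field_simp
    rw [h2, hl]
    field_simp
    linear_combination 3 * hr2
  have hle : ∀ x : Fin (m + 1) → Fin d,
      (if x ∈ deviationEvent P i j s T v then pathProb q P x else 0) ≤
      Real.exp (-T) * (pathProb q P x *
        Real.exp (l * (s * (Npair x i j - Ncount x i * P i j)) -
          w * (Ncount x i * (P i j * (1 - P i j))))) := by
    intro x
    have hpp := pathProb_nonneg hP0 hq.1 x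
    split_ifs with hx
    · rw [mul_left_comm, ← Real.exp_add]
      refine le_mul_of_one_le_right hpp (Real.one_le_exp ?_)
      obtain ⟨h1, h2⟩ := hx
      rw [hrv] at h1
      linarith [mul_le_mul_of_nonneg_left h1 hl0.le, mul_le_mul_of_nonneg_left h2 hw0]
    · positivity
  refine (Finset.sum_le_sum fun x _ => hle x).trans ?_
  rw [← Finset.mul_sum]
  exact mul_le_of_le_one_right (Real.exp_pos _).le
    (sum_pathProb_mul_exp_le hP0 hP1 hq i j hs hl0.le hl3)

/-- Peeling: a variance `V` is matched up to the factor `c` by a level of a geometric grid. -/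
lemma exists_peeling_level {c T V N : ℝ} (hc : 1 < c) (hT : 0 < T) (hV0 : 0 ≤ V) (hVN : V ≤ N) :
    ∃ k ≤ ⌈Real.logb c (2 * N / T)⌉₊, V ≤ T / 2 * c ^ k ∧
      Real.sqrt (2 * (T / 2 * c ^ k) * T) + T / 3 ≤ Real.sqrt (2 * c * V * T) + 4 / 3 * T := by
  have hc0 : 0 < c := by linarith
  have hex : ∃ k : ℕ, V ≤ T / 2 * c ^ k := by
    obtain ⟨k, hk⟩ := pow_unbounded_of_one_lt (2 * V / T) hc
    refine ⟨k, ?_⟩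
    rw [div_lt_iff₀ hT] at hk
    linarith
  have hK : V ≤ T / 2 * c ^ ⌈Real.logb c (2 * N / T)⌉₊ := by
    rcases (hV0.trans hVN).eq_or_lt with h | h
    · have : V = 0 := by linarith
      rw [this]
      positivity
    · have h1 := Nat.le_ceil (Real.logb c (2 * N / T))
      rw [Real.logb_le_iff_le_rpow hc (by positivity), Real.rpow_natCast, div_le_iff₀ hT] at h1
      linarith
  refine ⟨Nat.find hex, Nat.find_min' hex hK, Nat.find_spec hex, ?_⟩
  rcases hk : Nat.find hex with _ | k
  · have : Real.sqrt (2 * (T / 2 * c ^ 0) * T) = T := by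
      rw [show 2 * (T / 2 * c ^ 0) * T = T ^ 2 by ring, Real.sqrt_sq hT.le]
    rw [this]
    linarith [Real.sqrt_nonneg (2 * c * V * T)]
  · have hlt : ¬ V ≤ T / 2 * c ^ k := Nat.find_min hex (by omega)
    have : Real.sqrt (2 * (T / 2 * c ^ (k + 1)) * T) ≤ Real.sqrt (2 * c * V * T) := by
      refine Real.sqrt_le_sqrt ?_
      rw [pow_succ]
      have h1 := mul_le_mul_of_nonneg_left (not_le.1 hlt).le (mul_pos hc0 hT).le
      nlinarith
    linarith

/-- A Bernstein bound on the transition count gives the bound on the smoothed estimate. -/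
lemma smoothed_error_le {d n : ℕ} {P : Matrix (Fin d) (Fin d) ℝ} {α c T : ℝ}
    {x : Fin n → Fin d} {i j : Fin d} (hd : 0 < d) (hα : 0 < α)
    (h : |(Npair x i j : ℝ) - Ncount x i * P i j| ≤
      Real.sqrt (2 * c * (Ncount x i * (P i j * (1 - P i j))) * T) + 4 / 3 * T) :
    |Phat α x i j - P i j| ≤
      Real.sqrt (((Ncount x i : ℝ) / ((Ncount x i : ℝ) + d * α)) *
          (2 * c * P i j * (1 - P i j) * T) / ((Ncount x i : ℝ) + d * α)) +
        (4 / 3) * T / ((Ncount x i : ℝ) + d * α) +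
        |α - d * α * P i j| / ((Ncount x i : ℝ) + d * α) := by
  have hd' : (0 : ℝ) < d := Nat.cast_pos.2 hd
  set D : ℝ := (Ncount x i : ℝ) + d * α with hD
  have hD0 : 0 < D := by positivity
  have h1 : Real.sqrt (((Ncount x i : ℝ) / D) * (2 * c * P i j * (1 - P i j) * T) / D) =
      Real.sqrt (2 * c * (Ncount x i * (P i j * (1 - P i j))) * T) / D := by
    rw [show ((Ncount x i : ℝ) / D) * (2 * c * P i j * (1 - P i j) * T) / D =
      2 * c * (Ncount x i * (P i j * (1 - P i j))) * T / D ^ 2 by field_simp,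
      Real.sqrt_div' _ (sq_nonneg D), Real.sqrt_sq hD0.le]
  have h2 : Phat α x i j - P i j =
      ((Npair x i j - Ncount x i * P i j) + (α - d * α * P i j)) / D := by
    rw [Phat, Matrix.of_apply, ← hD]
    field_simp
    rw [hD]
    ring
  rw [h1, h2, abs_div, abs_of_pos hD0, ← add_div, ← add_div]
  gcongr
  exact (abs_add_le _ _).trans (by linarith)

/-- The infimum defining the threshold is positive and attained. -/
lemma that_spec (d n : ℕ) (c δ : ℝ) (hd : 0 < d) (hn : 0 < n) (hδ : 0 < δ) (hδ1 : δ < 1)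
    (hc : 1 < c) : 0 < that d n c δ ∧
    2 * (d : ℝ) ^ 2 * (1 + (⌈Real.logb c (2 * n / that d n c δ)⌉₊ : ℝ)) *
      Real.exp (-that d n c δ) ≤ δ := by
  have hd' : (1 : ℝ) ≤ d := Nat.one_le_cast.2 hd
  have hd2 : (1 : ℝ) ≤ (d : ℝ) ^ 2 := one_le_pow₀ hd'
  have hn' : (0 : ℝ) < n := Nat.cast_pos.2 hn
  set f : ℝ → ℝ := fun t =>
    2 * (d : ℝ) ^ 2 * (1 + (⌈Real.logb c (2 * n / t)⌉₊ : ℝ)) * Real.exp (-t) with hf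
  set S : Set ℝ := {t : ℝ | 0 ≤ t ∧ f t ≤ δ} with hS
  have hT : that d n c δ = sInf S := rfl
  have hlow : ∀ t ∈ S, Real.log 2 ≤ t := by
    rintro t ⟨-, ht⟩
    have h0 : (0 : ℝ) ≤ (⌈Real.logb c (2 * n / t)⌉₊ : ℝ) := Nat.cast_nonneg _
    have h1 : 2 * Real.exp (-t) ≤ f t := by
      refine mul_le_mul_of_nonneg_right ?_ (Real.exp_pos _).le
      nlinarith
    have h2 : Real.exp (-t) * Real.exp t = 1 := by rw [← Real.exp_add]; simp
    rw [Real.log_le_iff_le_exp two_pos]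
    nlinarith [Real.exp_pos t]
  have hne : S.Nonempty := by
    have htend : Filter.Tendsto (fun t : ℝ => 2 * (d : ℝ) ^ 2 * Real.exp (-t)) Filter.atTop
        (nhds 0) := by
      simpa using Real.tendsto_exp_neg_atTop_nhds_zero.const_mul (2 * (d : ℝ) ^ 2)
    obtain ⟨t, ht1, ht2⟩ := ((htend.eventually_lt_const hδ).and
      (Filter.eventually_ge_atTop (2 * (n : ℝ)))).exists
    have ht0 : 0 < t := by linarith
    have hceil : ⌈Real.logb c (2 * n / t)⌉₊ = 0 :=
      Nat.ceil_eq_zero.2 (Real.logb_nonpos hc (by positivity) ((div_le_one ht0).2 ht2))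
    refine ⟨t, ht0.le, ?_⟩
    simp only [hf, hceil, Nat.cast_zero, add_zero, mul_one]
    exact ht1.le
  have hTpos : 0 < sInf S := (Real.log_pos one_lt_two).trans_le (le_csInf hne hlow)
  have hgt : ∀ t, sInf S < t → f t ≤ δ := by
    intro t ht
    obtain ⟨u, hu, hut⟩ := exists_lt_of_csInf_lt hne ht
    have hu0 : 0 < u := (Real.log_pos one_lt_two).trans_le (hlow u hu)
    refine le_trans ?_ hu.2
    have ht0 : 0 < t := hu0.trans hut
    have hlog : Real.logb c (2 * n / t) ≤ Real.logb c (2 * n / u) :=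
      Real.logb_le_logb_of_le hc (by positivity) (by gcongr)
    simp only [hf]
    gcongr
  rw [hT]
  refine ⟨hTpos, ?_⟩
  set T := sInf S
  set K := ⌈Real.logb c (2 * n / T)⌉₊ with hK
  have hev : ∀ᶠ t in nhdsWithin T (Set.Ioi T), K ≤ ⌈Real.logb c (2 * n / t)⌉₊ := by
    rcases hK' : K with _ | k
    · simp
    · have hlt : (k : ℝ) < Real.logb c (2 * n / T) := Nat.lt_ceil.1 (by omega)
      have hcont : ContinuousAt (fun t : ℝ => Real.logb c (2 * n / t)) T := by
        have h1 : ContinuousAt (fun t : ℝ => 2 * (n : ℝ) / t) T :=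
          continuousAt_const.div continuousAt_id hTpos.ne'
        exact (h1.log (by positivity)).div_const _
      filter_upwards [nhdsWithin_le_nhds (hcont.eventually_const_lt hlt)] with t ht
      exact Nat.succ_le_of_lt (Nat.lt_ceil.2 ht)
  have hbound : ∀ᶠ t in nhdsWithin T (Set.Ioi T),
      2 * (d : ℝ) ^ 2 * (1 + (K : ℝ)) * Real.exp (-t) ≤ δ := by
    filter_upwards [hev, self_mem_nhdsWithin] with t ht htT
    refine le_trans ?_ (hgt t htT)
    simp only [hf]
    gcongr
  refine le_of_tendsto (Filter.Tendsto.mono_left ?_ nhdsWithin_le_nhds) hbound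
  exact Continuous.tendsto (by fun_prop) T

/-- empirical (unobservable) confidence bounds for the smoothed
transition probability estimates. -/
theorem statement12 (d n : ℕ) (P : Matrix (Fin d) (Fin d) ℝ) (q : Fin d → ℝ)
    (hP : IsStochastic P) (herg : IsErgodic P) (hq : IsProbVec q)
    (δ c α : ℝ) (hδ : 0 < δ) (hδ1 : δ < 1) (hc : 1 < c) (hα : 0 < α) :
    1 - δ ≤ prob q P {x : Fin n → Fin d | ∀ i j,
      |Phat α x i j - P i j| ≤
        Real.sqrt (((Ncount x i : ℝ) / ((Ncount x i : ℝ) + d * α)) *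
            (2 * c * P i j * (1 - P i j) * that d n c δ) / ((Ncount x i : ℝ) + d * α)) +
          (4 / 3) * that d n c δ / ((Ncount x i : ℝ) + d * α) +
          |α - d * α * P i j| / ((Ncount x i : ℝ) + d * α)} := by
  obtain ⟨hP0, hP1⟩ := hP
  rcases Nat.eq_zero_or_pos d with rfl | hd
  · simp [IsProbVec] at hq
  rcases n with _ | m
  · have hT : 0 ≤ that d 0 c δ := Real.sInf_nonneg fun t ht => ht.1
    rw [prob, Fintype.sum_unique, if_pos]
    · simp only [pathProb, Finset.univ_eq_empty, Finset.prod_empty]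
      linarith
    · exact fun i j => smoothed_error_le hd hα (by simp [Ncount, Npair]; positivity)
  set T := that d (m + 1) c δ with hTdef
  obtain ⟨hT, hTδ⟩ := that_spec d (m + 1) c δ hd m.succ_pos hδ hδ1 hc
  rw [← hTdef] at hT hTδ
  set K := ⌈Real.logb c (2 * ((m + 1 : ℕ) : ℝ) / T)⌉₊ with hK
  set E : Set (Fin (m + 1) → Fin d) := {x | ∀ i j,
      |Phat α x i j - P i j| ≤
        Real.sqrt (((Ncount x i : ℝ) / ((Ncount x i : ℝ) + d * α)) *
            (2 * c * P i j * (1 - P i j) * T) / ((Ncount x i : ℝ) + d * α)) +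
          (4 / 3) * T / ((Ncount x i : ℝ) + d * α) +
          |α - d * α * P i j| / ((Ncount x i : ℝ) + d * α)} with hE
  let A : (Fin d × Fin d) × Bool × Fin (K + 1) → Set (Fin (m + 1) → Fin d) := fun s =>
    deviationEvent P s.1.1 s.1.2 (if s.2.1 then 1 else -1) T (T / 2 * c ^ (s.2.2 : ℕ))
  have hcover : ∀ x, x ∈ Eᶜ → ∃ s ∈ Finset.univ, x ∈ A s := by
    intro x hx
    simp only [hE, Set.mem_compl_iff, Set.mem_ofPred_eq, not_forall] at hx
    obtain ⟨i, j, hij⟩ := hx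
    have hS := mt (smoothed_error_le hd hα) hij
    have hp0 := hP0 i j
    have hp1 : P i j ≤ 1 := (hP1 i).symm ▸
      Finset.single_le_sum (fun b _ => hP0 i b) (Finset.mem_univ j)
    have hV0 : 0 ≤ (Ncount x i : ℝ) * (P i j * (1 - P i j)) :=
      mul_nonneg (Nat.cast_nonneg _) (mul_nonneg hp0 (by linarith))
    have hN : (Ncount x i : ℝ) ≤ ((m + 1 : ℕ) : ℝ) := by
      exact_mod_cast (Finset.card_le_univ _).trans (by simp)
    have hVn : (Ncount x i : ℝ) * (P i j * (1 - P i j)) ≤ ((m + 1 : ℕ) : ℝ) :=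
      (mul_le_of_le_one_right (Nat.cast_nonneg _) (by nlinarith)).trans hN
    obtain ⟨k, hk, hVk, hsq⟩ := exists_peeling_level hc hT hV0 hVn
    rw [not_le] at hS
    rcases le_abs'.1 hS.le with h | h
    · refine ⟨((i, j), false, ⟨k, Nat.lt_succ_of_le hk⟩), Finset.mem_univ _, ?_, hVk⟩
      simp only [Bool.false_eq_true, if_false]
      linarith
    · refine ⟨((i, j), true, ⟨k, Nat.lt_succ_of_le hk⟩), Finset.mem_univ _, ?_, hVk⟩
      simp only [if_true]
      linarith
  have hbad : prob q P Eᶜ ≤ δ := by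
    refine (prob_le_sum hP0 hq.1 _ A _ hcover).trans ?_
    refine (Finset.sum_le_card_nsmul _ _ (Real.exp (-T)) fun s _ => ?_).trans ?_
    · refine prob_deviationEvent_le hP0 hP1 hq _ _ ?_ hT (by positivity)
      split_ifs <;> simp
    · simp only [Finset.card_univ, Fintype.card_prod, Fintype.card_fin, Fintype.card_bool,
        nsmul_eq_mul]
      refine le_trans (le_of_eq ?_) hTδ
      push_cast
      ring
  have := prob_add_prob_compl (q := q) (P := P) E
  rw [prob_univ hP1 hq] at this
  linarith

end MCEst
end

section
/- For any states i, j ∈ [d], the expected first positive hitting time of state j starting from state i satisfies E_i[τ_j] ≤ 2·( t_mix + 8·t_relax/π_j ), where τ_j = min{ t ≥ 1 : X_t = j } for the chain started at X_0 = i. -/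
open Finset Matrix Real MeasureTheory
open scoped Classical BigOperators

namespace MCEst

/-- The spectral decomposition of a reversible matrix in the inner product weighted by the
stationary distribution. -/
lemma exists_eigenbasis_of_isReversible {d : ℕ} {P : Matrix (Fin d) (Fin d) ℝ} {w : Fin d → ℝ}
    (hrev : IsReversible P w) (hpos : ∀ i, 0 < w i) :
    ∃ (lam : Fin d → ℝ) (v : Fin d → Fin d → ℝ),
      (∀ k, P *ᵥ v k = lam k • v k) ∧ (∀ k, v k ≠ 0) ∧
      ∀ g : Fin d → ℝ, ∑ k, (∑ l, w l * v k l * g l) • v k = g := by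
  have hs : ∀ i, 0 < √(w i) := fun i => Real.sqrt_pos.mpr (hpos i)
  have hsq : ∀ i, √(w i) * √(w i) = w i := fun i => Real.mul_self_sqrt (hpos i).le
  have hL : (Lgen w P).IsHermitian := by
    ext i j
    have h := hrev i j
    have hi := (hs i).ne'
    have hj := (hs j).ne'
    simp only [Lgen, conjTranspose_apply, of_apply, star_trivial]
    rw [div_eq_div_iff hi hj]
    calc √(w j) * P j i * √(w j) = (√(w j) * √(w j)) * P j i := by ring
      _ = (√(w i) * √(w i)) * P i j := by rw [hsq, hsq, h]
      _ = √(w i) * P i j * √(w i) := by ring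
  obtain ⟨lam, b, hlam⟩ : ∃ (lam : Fin d → ℝ) (b : OrthonormalBasis (Fin d) ℝ
      (EuclideanSpace ℝ (Fin d))), ∀ k, Lgen w P *ᵥ ⇑(b k) = lam k • ⇑(b k) :=
    ⟨hL.eigenvalues, hL.eigenvectorBasis, hL.mulVec_eigenvectorBasis⟩
  refine ⟨lam, fun k l => b k l / √(w l), fun k => ?_, fun k h0 => ?_, fun g => ?_⟩
  · ext i
    have h := congrFun (hlam k) i
    simp only [mulVec, dotProduct, Lgen, of_apply, Pi.smul_apply, smul_eq_mul] at h ⊢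
    rw [mul_div_assoc', eq_div_iff (hs i).ne', ← h, Finset.sum_mul]
    exact Finset.sum_congr rfl fun l _ => by ring
  · refine b.orthonormal.ne_zero k ?_
    ext l
    have h := congrFun h0 l
    simpa [(hs l).ne'] using h
  · ext i
    have h := congrArg (fun x : EuclideanSpace ℝ (Fin d) => x i)
      (b.sum_repr' (WithLp.toLp 2 fun l => √(w l) * g l))
    simp only [PiLp.inner_apply, WithLp.ofLp_sum, Finset.sum_apply, PiLp.smul_apply,
      smul_eq_mul, RCLike.inner_apply, conj_trivial] at h
    simp only [Finset.sum_apply, Pi.smul_apply, smul_eq_mul]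
    refine mul_left_cancel₀ (hs i).ne' ?_
    rw [← h, Finset.mul_sum]
    refine Finset.sum_congr rfl fun k _ => ?_
    have : ∑ l, w l * (b k l / √(w l)) * g l = ∑ l, √(w l) * g l * b k l := by
      refine Finset.sum_congr rfl fun l _ => ?_
      nth_rewrite 1 [← hsq l]
      have := (hs l).ne'
      field_simp
    rw [this]
    have := (hs i).ne'
    field_simp

lemma IsStochastic.pow {d : ℕ} {P : Matrix (Fin d) (Fin d) ℝ} (hP : IsStochastic P) (n : ℕ) :
    IsStochastic (P ^ n) := by
  induction n with
  | zero =>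
    refine ⟨fun i j => ?_, fun i => by simp [one_apply]⟩
    rw [pow_zero, one_apply]
    split_ifs <;> norm_num
  | succ n ih =>
    refine ⟨fun i j => ?_, fun i => ?_⟩
    · rw [pow_succ, mul_apply]
      exact Finset.sum_nonneg fun k _ => mul_nonneg (ih.1 i k) (hP.1 k j)
    · simp only [pow_succ, mul_apply]
      rw [Finset.sum_comm]
      simp [← Finset.mul_sum, hP.2, ih.2]

lemma pow_mulVec_of_mulVec_eq_smul {d : ℕ} {P : Matrix (Fin d) (Fin d) ℝ} {v : Fin d → ℝ}
    {mu : ℝ} (h : P *ᵥ v = mu • v) (n : ℕ) : P ^ n *ᵥ v = mu ^ n • v := by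
  induction n with
  | zero => simp
  | succ n ih => rw [pow_succ, ← mulVec_mulVec, h, mulVec_smul, ih, smul_smul, pow_succ, mul_comm]

/-- A real eigenvalue of an ergodic chain of modulus at least one is equal to one, and its
eigenvectors are constant. -/
lemma eq_one_and_const_of_one_le_abs {d : ℕ} {P : Matrix (Fin d) (Fin d) ℝ}
    (hP : IsStochastic P) (herg : IsErgodic P) {v : Fin d → ℝ} {mu : ℝ} (hv : v ≠ 0)
    (h : P *ᵥ v = mu • v) (hmu : 1 ≤ |mu|) : mu = 1 ∧ ∀ i j, v i = v j := by
  obtain ⟨k, hk⟩ := herg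
  obtain ⟨i₀, hi₀⟩ := Function.ne_iff.mp hv
  have : Nonempty (Fin d) := ⟨i₀⟩
  obtain ⟨m, hm⟩ := Finite.exists_max fun i => |v i|
  have hm0 : 0 < |v m| := (abs_pos.mpr hi₀).trans_le (hm i₀)
  have hS := hP.pow k
  have hkm : ∑ l, (P ^ k) m l * v l = mu ^ k * v m := by
    have := congrFun (pow_mulVec_of_mulVec_eq_smul h k) m
    simpa [mulVec, dotProduct] using this
  have key : ∀ s : ℝ, |s| = 1 → |mu ^ k * v m| = s * (mu ^ k * v m) → ∀ l, s * v l = |v m| := by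
    intro s hs1 hs l
    by_contra hne
    have hle : ∀ l, s * v l ≤ |v m| := fun l =>
      (le_abs_self _).trans (by rw [abs_mul, hs1, one_mul]; exact hm l)
    have hlt : ∑ l, (P ^ k) m l * (s * v l) < ∑ l, (P ^ k) m l * |v m| :=
      Finset.sum_lt_sum (fun l _ => mul_le_mul_of_nonneg_left (hle l) (hS.1 m l))
        ⟨l, Finset.mem_univ _, mul_lt_mul_of_pos_left (lt_of_le_of_ne (hle l) hne) (hk m l)⟩
    rw [← Finset.sum_mul, hS.2, one_mul] at hlt
    have heq : ∑ l, (P ^ k) m l * (s * v l) = |mu ^ k * v m| := by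
      rw [hs, ← hkm, Finset.mul_sum]
      exact Finset.sum_congr rfl fun l _ => by ring
    rw [heq, abs_mul, abs_pow] at hlt
    have := one_le_pow₀ hmu (n := k)
    nlinarith
  have hconst : ∀ i j, v i = v j := by
    intro i j
    rcases abs_choice (mu ^ k * v m) with h1 | h1
    · have := key 1 (by simp) (by rw [h1, one_mul])
      linarith [this i, this j]
    · have := key (-1) (by simp) (by rw [h1]; ring)
      linarith [this i, this j]
  refine ⟨?_, hconst⟩
  have h1 := congrFun h m
  simp only [mulVec, dotProduct, Pi.smul_apply, smul_eq_mul] at h1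
  simp only [hconst _ m] at h1
  rw [← Finset.sum_mul, hP.2] at h1
  exact (mul_right_cancel₀ (abs_pos.mp hm0) h1).symm

lemma isRoot_charpoly_iff_exists_mulVec {d : ℕ} {P : Matrix (Fin d) (Fin d) ℝ} {mu : ℝ} :
    P.charpoly.IsRoot mu ↔ ∃ v, v ≠ 0 ∧ P *ᵥ v = mu • v := by
  rw [Polynomial.IsRoot.def, eval_charpoly, ← exists_mulVec_eq_zero_iff]
  refine exists_congr fun v => and_congr_right fun _ => ?_
  rw [sub_mulVec, sub_eq_zero, eq_comm]
  simp [scalar_apply, ← smul_one_eq_diagonal, smul_mulVec]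

lemma finite_abs_eigenvalues_ne_one {d : ℕ} (P : Matrix (Fin d) (Fin d) ℝ) :
    {x : ℝ | ∃ mu : ℝ, mu ≠ 1 ∧ P.charpoly.IsRoot mu ∧ x = |mu|}.Finite := by
  refine ((Polynomial.finite_setOfPred_isRoot P.charpoly_monic.ne_zero).image fun x => |x|).subset ?_
  rintro x ⟨mu, -, hmu, rfl⟩
  exact ⟨mu, hmu, rfl⟩

lemma abs_le_one_sub_absSpectralGap {d : ℕ} {P : Matrix (Fin d) (Fin d) ℝ} {mu : ℝ}
    (h1 : mu ≠ 1) (hmu : P.charpoly.IsRoot mu) : |mu| ≤ 1 - absSpectralGap P := by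
  rw [absSpectralGap, sub_sub_cancel]
  exact le_csSup (finite_abs_eigenvalues_ne_one P).bddAbove ⟨mu, h1, hmu, rfl⟩

lemma absSpectralGap_le_one {d : ℕ} (P : Matrix (Fin d) (Fin d) ℝ) : absSpectralGap P ≤ 1 := by
  rw [absSpectralGap, sub_le_self_iff]
  refine Real.sSup_nonneg ?_
  rintro x ⟨mu, -, -, rfl⟩
  exact abs_nonneg mu

lemma absSpectralGap_pos {d : ℕ} {P : Matrix (Fin d) (Fin d) ℝ}
    (hP : IsStochastic P) (herg : IsErgodic P) : 0 < absSpectralGap P := by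
  rw [absSpectralGap, sub_pos]
  rcases Set.eq_empty_or_nonempty
    {x : ℝ | ∃ mu : ℝ, mu ≠ 1 ∧ P.charpoly.IsRoot mu ∧ x = |mu|} with h | h
  · rw [h, Real.sSup_empty]
    exact one_pos
  · obtain ⟨mu, hne, hroot, hx⟩ := h.csSup_mem (finite_abs_eigenvalues_ne_one P)
    rw [hx]
    by_contra! hge
    obtain ⟨v, hv, hPv⟩ := isRoot_charpoly_iff_exists_mulVec.mp hroot
    exact hne (eq_one_and_const_of_one_le_abs hP herg hv hPv hge).1

/-- For an ergodic reversible chain, each spectral component either carries an eigenvalue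
within the spectral gap, or is orthogonal to every function of mean zero. -/
lemma exists_eigenbasis_of_isErgodic {d : ℕ} {P : Matrix (Fin d) (Fin d) ℝ} {w : Fin d → ℝ}
    (hP : IsStochastic P) (herg : IsErgodic P)
    (hrev : IsReversible P w) (hpos : ∀ i, 0 < w i) :
    ∃ (lam : Fin d → ℝ) (v : Fin d → Fin d → ℝ),
      (∀ k, P *ᵥ v k = lam k • v k) ∧
      (∀ g : Fin d → ℝ, ∑ k, (∑ l, w l * v k l * g l) • v k = g) ∧
      ∀ g : Fin d → ℝ, ∑ l, w l * g l = 0 →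
        ∀ k, |lam k| ≤ 1 - absSpectralGap P ∨ ∑ l, w l * v k l * g l = 0 := by
  obtain ⟨lam, v, hv, hv0, hg⟩ := exists_eigenbasis_of_isReversible hrev hpos
  refine ⟨lam, v, hv, hg, fun g hg0 k => ?_⟩
  by_cases h1 : lam k = 1
  · right
    have hc := (eq_one_and_const_of_one_le_abs hP herg (hv0 k) (hv k) (by simp [h1])).2
    calc ∑ l, w l * v k l * g l = v k k * ∑ l, w l * g l := by
          rw [Finset.mul_sum]
          exact Finset.sum_congr rfl fun l _ => by rw [hc l k]; ring
      _ = 0 := by rw [hg0, mul_zero]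
  · exact .inl (abs_le_one_sub_absSpectralGap h1
      (isRoot_charpoly_iff_exists_mulVec.mpr ⟨v k, hv0 k, hv k⟩))

lemma tendsto_pow_mulVec_of_mean_zero {d : ℕ} {P : Matrix (Fin d) (Fin d) ℝ} {w : Fin d → ℝ}
    (hP : IsStochastic P) (herg : IsErgodic P)
    (hrev : IsReversible P w) (hpos : ∀ i, 0 < w i) {g : Fin d → ℝ}
    (hg0 : ∑ l, w l * g l = 0) (i : Fin d) :
    Filter.Tendsto (fun n : ℕ => (P ^ n *ᵥ g) i) Filter.atTop (nhds 0) := by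
  obtain ⟨lam, v, hv, hg, hor⟩ := exists_eigenbasis_of_isErgodic hP herg hrev hpos
  have hexp : ∀ n : ℕ, (P ^ n *ᵥ g) i = ∑ k, (∑ l, w l * v k l * g l) * (lam k ^ n * v k i) := by
    intro n
    conv_lhs => rw [← hg g]
    rw [mulVec_sum]
    simp [mulVec_smul, pow_mulVec_of_mulVec_eq_smul (hv _)]
  simp only [hexp]
  rw [show (0 : ℝ) = ∑ _k : Fin d, (0 : ℝ) by simp]
  refine tendsto_finsetSum _ fun k _ => ?_
  rcases hor g hg0 k with h | h
  · have hlt : |lam k| < 1 := h.trans_lt (by linarith [absSpectralGap_pos hP herg])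
    simpa using ((tendsto_pow_atTop_nhds_zero_of_abs_lt_one hlt).mul_const (v k i)).const_mul
      (∑ l, w l * v k l * g l)
  · simp [h]

lemma mixingTime_spec {d : ℕ} {P : Matrix (Fin d) (Fin d) ℝ} {w : Fin d → ℝ}
    (hP : IsStochastic P) (herg : IsErgodic P) (hst : IsStationary P w)
    (hrev : IsReversible P w) (hpos : ∀ i, 0 < w i) {q : Fin d → ℝ} (hq : IsProbVec q)
    (A : Finset (Fin d)) :
    |∑ i ∈ A, ((q ᵥ* (P ^ mixingTime P w)) i - w i)| ≤ 1 / 4 := by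
  suffices h : {t : ℕ | ∀ q : Fin d → ℝ, IsProbVec q →
      ∀ A : Finset (Fin d), |∑ i ∈ A, ((q ᵥ* (P ^ t)) i - w i)| ≤ 1 / 4}.Nonempty from
    Nat.sInf_mem h q hq A
  have hsum : ∀ (A : Finset (Fin d)),
      ∑ l, w l * ((if l ∈ A then 1 else 0) - ∑ m ∈ A, w m) = 0 := by
    intro A
    simp [mul_sub, Finset.sum_sub_distrib, ← Finset.sum_mul, hst.1.2]
  have hev : ∀ᶠ n : ℕ in Filter.atTop, ∀ (A : Finset (Fin d)) (i : Fin d),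
      |(P ^ n *ᵥ fun l => (if l ∈ A then 1 else 0) - ∑ m ∈ A, w m) i| ≤ 1 / 4 := by
    rw [Filter.eventually_all]
    intro A
    rw [Filter.eventually_all]
    intro i
    have := (tendsto_pow_mulVec_of_mean_zero hP herg hrev hpos (hsum A) i).abs
    rw [abs_zero] at this
    exact this.eventually_le_const (by norm_num)
  obtain ⟨n, hn⟩ := hev.exists
  refine ⟨n, fun q hq A => ?_⟩
  have hrow : ∀ i, (P ^ n *ᵥ fun l => (if l ∈ A then 1 else 0) - ∑ m ∈ A, w m) i =
      ∑ l ∈ A, (P ^ n) i l - ∑ m ∈ A, w m := by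
    intro i
    simp [mulVec, dotProduct, mul_sub, Finset.sum_sub_distrib, ← Finset.sum_mul, (hP.pow n).2]
  have heq : ∑ i ∈ A, ((q ᵥ* (P ^ n)) i - w i) =
      ∑ i, q i * (∑ l ∈ A, (P ^ n) i l - ∑ m ∈ A, w m) := by
    simp only [mul_sub, Finset.sum_sub_distrib, ← Finset.sum_mul, hq.2, one_mul, vecMul,
      dotProduct]
    rw [Finset.sum_comm]
    simp only [Finset.mul_sum]
  rw [heq]
  calc |∑ i, q i * (∑ l ∈ A, (P ^ n) i l - ∑ m ∈ A, w m)|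
      ≤ ∑ i, q i * (1 / 4) := by
        refine (Finset.abs_sum_le_sum_abs _ _).trans (Finset.sum_le_sum fun i _ => ?_)
        rw [abs_mul, abs_of_nonneg (hq.1 i), ← hrow i]
        exact mul_le_mul_of_nonneg_left (hn A i) (hq.1 i)
    _ = 1 / 4 := by rw [← Finset.sum_mul, hq.2, one_mul]

/-- The mean of a nonnegative bounded function after `mixingTime` steps exceeds its stationary
mean by at most a quarter of its bound. -/
lemma pow_mixingTime_mulVec_le {d : ℕ} {P : Matrix (Fin d) (Fin d) ℝ} {w : Fin d → ℝ}
    (hP : IsStochastic P) (herg : IsErgodic P) (hst : IsStationary P w)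
    (hrev : IsReversible P w) (hpos : ∀ i, 0 < w i) {f : Fin d → ℝ} {F : ℝ}
    (hf0 : ∀ l, 0 ≤ f l) (hfF : ∀ l, f l ≤ F) (i : Fin d) :
    (P ^ mixingTime P w *ᵥ f) i ≤ ∑ l, w l * f l + F / 4 := by
  set Q := P ^ mixingTime P w with hQ
  have hF : 0 ≤ F := (hf0 i).trans (hfF i)
  have hq : IsProbVec (Pi.single i 1 : Fin d → ℝ) := by
    refine ⟨fun l => ?_, by simp⟩
    rw [Pi.single_apply]
    split_ifs <;> norm_num
  have hA := (le_abs_self _).trans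
    (mixingTime_spec hP herg hst hrev hpos hq (univ.filter fun l => w l ≤ Q i l))
  simp only [← hQ, single_one_vecMul, row_apply] at hA
  calc (Q *ᵥ f) i = ∑ l, w l * f l + ∑ l, (Q i l - w l) * f l := by
        rw [← Finset.sum_add_distrib]
        simp only [mulVec, dotProduct]
        exact Finset.sum_congr rfl fun l _ => by ring
    _ ≤ ∑ l, w l * f l + ∑ l, (if w l ≤ Q i l then Q i l - w l else 0) * F := by
        refine add_le_add le_rfl (Finset.sum_le_sum fun l _ => ?_)
        split_ifs with h
        · exact mul_le_mul_of_nonneg_left (hfF l) (sub_nonneg.mpr h)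
        · rw [zero_mul]
          exact mul_nonpos_of_nonpos_of_nonneg (by linarith) (hf0 l)
    _ ≤ ∑ l, w l * f l + F / 4 := by
        rw [← Finset.sum_mul, ← Finset.sum_filter]
        nlinarith

/-- The Poisson equation for hitting `j`: the solution vanishing at `j` is nonnegative and its
stationary mean is controlled by the spectral gap. -/
lemma exists_poisson_solution {d : ℕ} {P : Matrix (Fin d) (Fin d) ℝ} {w : Fin d → ℝ}
    (hP : IsStochastic P) (herg : IsErgodic P) (hst : IsStationary P w)
    (hrev : IsReversible P w) (hpos : ∀ i, 0 < w i) (j : Fin d) :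
    ∃ f : Fin d → ℝ, f j = 0 ∧ (∀ l, 0 ≤ f l) ∧
      (∀ l, f l = (P *ᵥ f) l + 1 - if l = j then 1 / w j else 0) ∧
      ∑ l, w l * f l ≤ 1 / absSpectralGap P / w j := by
  obtain ⟨lam, v, hv, hg, hor⟩ := exists_eigenbasis_of_isErgodic hP herg hrev hpos
  have hgap := absSpectralGap_pos hP herg
  have hwj := (hpos j).ne'
  set g : Fin d → ℝ := fun l => 1 - if l = j then 1 / w j else 0 with hgdef
  have hwg : ∀ u : Fin d → ℝ, ∑ l, w l * u l * g l = ∑ l, w l * u l - u j := by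
    intro u
    simp only [hgdef, mul_sub, mul_one, Finset.sum_sub_distrib, mul_ite, mul_zero,
      Finset.sum_ite_eq', Finset.mem_univ, if_true]
    field_simp
  have hg0 : ∑ l, w l * g l = 0 := by
    have := hwg 1
    simpa [hst.1.2] using this
  set c : Fin d → ℝ := fun k => ∑ l, w l * v k l * g l with hc
  set u : Fin d → ℝ := ∑ k, (c k / (1 - lam k)) • v k with hu
  have hck : ∀ k, absSpectralGap P ≤ 1 - lam k ∨ c k = 0 := fun k =>
    (hor g hg0 k).imp (fun h => by linarith [le_abs_self (lam k)]) id
  have hPu : P *ᵥ u = u - g := by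
    conv_rhs => rw [← hg g]
    rw [hu, mulVec_sum, ← Finset.sum_sub_distrib]
    refine Finset.sum_congr rfl fun k _ => ?_
    rw [mulVec_smul, hv, smul_smul, ← sub_smul]
    congr 1
    change _ = c k / (1 - lam k) - c k
    rcases hck k with h | h
    · have : 1 - lam k ≠ 0 := by linarith
      field_simp
      ring
    · simp [h]
  have hPf : ∀ l, (P *ᵥ fun m => u m - u j) l = (P *ᵥ u) l - u j := by
    intro l
    simp [mulVec, dotProduct, mul_sub, Finset.sum_sub_distrib, ← Finset.sum_mul, hP.2]
  have heq : ∀ l, u l - u j = (P *ᵥ fun m => u m - u j) l + 1 - if l = j then 1 / w j else 0 := by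
    intro l
    rw [hPf, hPu]
    simp only [Pi.sub_apply, hgdef]
    ring
  have hpar : ∑ k, c k * c k = ∑ l, w l * g l * g l := by
    have : ∀ l, g l = ∑ k, c k * v k l := fun l => by
      have := congrFun (hg g) l
      simpa using this.symm
    calc ∑ k, c k * c k = ∑ k, ∑ l, w l * g l * (c k * v k l) := by
          refine Finset.sum_congr rfl fun k _ => ?_
          nth_rewrite 2 [hc]
          rw [Finset.mul_sum]
          exact Finset.sum_congr rfl fun l _ => by ring
      _ = ∑ l, w l * g l * ∑ k, c k * v k l := by
          rw [Finset.sum_comm]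
          simp only [Finset.mul_sum]
      _ = _ := Finset.sum_congr rfl fun l _ => by rw [← this l]
  refine ⟨fun l => u l - u j, sub_self _, fun l => ?_, heq, ?_⟩
  · have : Nonempty (Fin d) := ⟨j⟩
    obtain ⟨m, hm⟩ := Finite.exists_min u
    suffices m = j by simpa [this] using hm l
    by_contra hmj
    have h1 := congrFun hPu m
    simp only [Pi.sub_apply, hgdef, if_neg hmj, sub_zero] at h1
    have h2 : ∑ l, P m l * u m ≤ (P *ᵥ u) m := by
      simp only [mulVec, dotProduct]
      exact Finset.sum_le_sum fun l _ => mul_le_mul_of_nonneg_left (hm l) (hP.1 m l)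
    rw [← Finset.sum_mul, hP.2] at h2
    linarith
  · calc ∑ l, w l * (u l - u j) = ∑ l, w l * u l * g l := by
          rw [hwg]
          simp [mul_sub, Finset.sum_sub_distrib, ← Finset.sum_mul, hst.1.2]
      _ = ∑ k, c k / (1 - lam k) * c k := by
          simp only [hu, Finset.sum_apply, Pi.smul_apply, smul_eq_mul, Finset.mul_sum,
            Finset.sum_mul]
          rw [Finset.sum_comm]
          refine Finset.sum_congr rfl fun k _ => ?_
          nth_rewrite 3 [hc]
          rw [Finset.mul_sum]
          exact Finset.sum_congr rfl fun l _ => by ring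
      _ ≤ ∑ k, 1 / absSpectralGap P * (c k * c k) := by
          refine Finset.sum_le_sum fun k _ => ?_
          rcases hck k with h | h
          · calc c k / (1 - lam k) * c k = 1 / (1 - lam k) * (c k * c k) := by ring
              _ ≤ _ := mul_le_mul_of_nonneg_right (one_div_le_one_div_of_le hgap h)
                  (mul_self_nonneg _)
          · simp [h]
      _ = 1 / absSpectralGap P * (1 / w j - 1) := by
          rw [← Finset.mul_sum, hpar, hwg, hg0]
          simp [hgdef]
      _ ≤ 1 / absSpectralGap P / w j := by
          have : 0 ≤ 1 / absSpectralGap P := by positivity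
          rw [mul_sub, mul_one_div]
          linarith

/-- A nonnegative supersolution of the first-step equations dominates the expected hitting
time. -/
lemma expHit_le_of_supersolution {d : ℕ} {P : Matrix (Fin d) (Fin d) ℝ} (hP : IsStochastic P)
    {j : Fin d} {h : Fin d → ℝ} (h0 : ∀ l, 0 ≤ h l)
    (hh : ∀ l, 1 + (avoid P j *ᵥ h) l ≤ h l) (i : Fin d) : expHit P i j ≤ h i := by
  have hQ : ∀ (n : ℕ) k l, 0 ≤ (avoid P j ^ n) k l := by
    intro n
    induction n with
    | zero =>
      intro k l
      rw [pow_zero, one_apply]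
      split_ifs <;> norm_num
    | succ n ih =>
      intro k l
      rw [pow_succ, mul_apply]
      refine Finset.sum_nonneg fun m _ => mul_nonneg (ih k m) ?_
      simp only [avoid, of_apply]
      split_ifs
      exacts [le_rfl, hP.1 m l]
  have hpart : ∀ n : ℕ,
      ∑ t ∈ Finset.range n, ∑ l, (avoid P j ^ t) i l + (avoid P j ^ n *ᵥ h) i ≤ h i := by
    intro n
    induction n with
    | zero => simp
    | succ n ih =>
      refine le_trans ?_ ih
      rw [Finset.sum_range_succ, add_assoc]
      refine add_le_add le_rfl ?_
      rw [pow_succ, ← mulVec_mulVec]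
      simp only [mulVec, dotProduct] at hh ⊢
      rw [← Finset.sum_add_distrib]
      refine Finset.sum_le_sum fun l _ => ?_
      have := mul_le_mul_of_nonneg_left (hh l) (hQ n i l)
      linarith
  refine Real.tsum_le_of_sum_range_le (fun t => Finset.sum_nonneg fun l _ => hQ t i l) fun n => ?_
  have : 0 ≤ (avoid P j ^ n *ᵥ h) i := by
    simp only [mulVec, dotProduct]
    exact Finset.sum_nonneg fun l _ => mul_nonneg (hQ n i l) (h0 l)
  linarith [hpart n]

/-- expected hitting times are bounded by mixing and relaxation
times. -/
theorem statement17 (d : ℕ) (P : Matrix (Fin d) (Fin d) ℝ) (w : Fin d → ℝ)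
    (hP : IsStochastic P) (herg : IsErgodic P) (hst : IsStationary P w)
    (hrev : IsReversible P w) (hpos : ∀ i, 0 < w i)
    (i j : Fin d) :
    expHit P i j ≤
      2 * ((mixingTime P w : ℝ) + 8 * (1 / absSpectralGap P) / w j) := by
  obtain ⟨f, hfj, hf0, hf, hmean⟩ := exists_poisson_solution hP herg hst hrev hpos j
  have hwj := hpos j
  have hgap := absSpectralGap_pos hP herg
  have hinv : 1 / w j ≤ 1 / absSpectralGap P / w j := by
    gcongr
    exact (one_le_div hgap).mpr (absSpectralGap_le_one P)
  have hinv0 : 0 < 1 / w j := by positivity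
  have hit : expHit P i j ≤ f i + if i = j then 1 / w j else 0 := by
    refine expHit_le_of_supersolution hP (h := fun l => f l + if l = j then 1 / w j else 0)
      (fun l => ?_) (fun l => ?_) i
    · have := hf0 l
      positivity
    · have h1 : (avoid P j *ᵥ fun l => f l + if l = j then 1 / w j else 0) l = (P *ᵥ f) l := by
        simp only [mulVec, dotProduct]
        refine Finset.sum_congr rfl fun m _ => ?_
        by_cases hm : m = j <;> simp [avoid, hm, hfj]
      rw [h1]
      linarith [hf l]
  have hstep : ∀ (n : ℕ) l, f l ≤ n + (P ^ n *ᵥ f) l := by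
    intro n
    induction n with
    | zero => simp
    | succ n ih =>
      intro l
      refine (ih l).trans ?_
      have hle : (P ^ n *ᵥ f) l ≤ 1 + (P ^ (n + 1) *ᵥ f) l := by
        rw [pow_succ, ← mulVec_mulVec]
        calc (P ^ n *ᵥ f) l ≤ ∑ m, (P ^ n) l m * (1 + (P *ᵥ f) m) := by
              conv_lhs => simp only [mulVec, dotProduct]
              refine Finset.sum_le_sum fun m _ =>
                mul_le_mul_of_nonneg_left ?_ ((hP.pow n).1 l m)
              have : 0 ≤ if m = j then 1 / w j else 0 := by positivity
              linarith [hf m]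
          _ = 1 + (P ^ n *ᵥ (P *ᵥ f)) l := by
              simp only [mul_add, mul_one, Finset.sum_add_distrib, (hP.pow n).2]
              rfl
      push_cast
      linarith
  have : Nonempty (Fin d) := ⟨j⟩
  obtain ⟨m, hm⟩ := Finite.exists_max f
  have hmix := pow_mixingTime_mulVec_le hP herg hst hrev hpos hf0 hm m
  have hmstep := hstep (mixingTime P w) m
  have hti : (0 : ℝ) ≤ mixingTime P w := Nat.cast_nonneg _
  rw [mul_div_assoc]
  by_cases hij : i = j
  · rw [if_pos hij, hij, hfj] at hit
    rw [hij]
    linarith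
  · rw [if_neg hij] at hit
    linarith [hm i]

end MCEst
end
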